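/- Let 𝒞 be a set of cost functions that is closed under composition and consistent for unweighted resource graph games. Then for every c ∈ 𝒞 with c : ℤ_{≥0}^m → ℝ^m, for all r, s ∈ {1,…,m} with r ≠ s and all x, y ∈ ℤ_{≥0}^m with x_r > 0 and y_r > 0, it holds that c_r(x + 1_s) − c_r(x) = c_r(y + 1_s) − c_r(y). -/

import Mathlib

open Finset

/-- The indicator vector of a set `S` of resources. -/
def indicVec {m : ℕ} (S : Finset (Fin m)) : Fin m → ℕ :=
  fun r => if r ∈ S then 1 else 0

/-- The load vector induced by a strategy profile `x`. -/
def loadVec {n m : ℕ} (x : Fin n → Fin m → ℕ) : Fin m → ℕ :=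
  fun r => ∑ i, x i r

/-- The private cost of player `i` in profile `x` with cost function `c`. -/
def playerCost {n m : ℕ} (c : (Fin m → ℕ) → Fin m → ℝ)
    (x : Fin n → Fin m → ℕ) (i : Fin n) : ℝ :=
  ∑ r, (x i r : ℝ) * c (loadVec x) r

/-- `X` is a valid system of strategy sets for an unweighted resource graph game:
each `X i` is a nonempty finite set of `0/1`-vectors. -/
def IsStrategySets {n m : ℕ} (X : Fin n → Finset (Fin m → ℕ)) : Prop :=
  (∀ i, (X i).Nonempty) ∧ ∀ i, ∀ v ∈ X i, ∀ r, v r ≤ 1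

/-- `x` is a pure Nash equilibrium of the unweighted resource graph game with
strategy sets `X` and cost function `c`. -/
def IsPNE {n m : ℕ} (c : (Fin m → ℕ) → Fin m → ℝ)
    (X : Fin n → Finset (Fin m → ℕ)) (x : Fin n → Fin m → ℕ) : Prop :=
  (∀ i, x i ∈ X i) ∧
    ∀ i, ∀ y ∈ X i, playerCost c x i ≤ playerCost c (Function.update x i y) i

/-- The composition `c ⊕ c'` of two cost functions. -/
def oplus {m m' : ℕ} (c : (Fin m → ℕ) → Fin m → ℝ)
    (c' : (Fin m' → ℕ) → Fin m' → ℝ) :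
    (Fin (m + m') → ℕ) → Fin (m + m') → ℝ :=
  fun x => Fin.addCases (motive := fun _ => ℝ)
    (fun i => c (fun j => x (Fin.castAdd m' j)) i)
    (fun i => c' (fun j => x (Fin.natAdd m j)) i)

/-- A set of cost functions, one set for each number `m` of resources. -/
abbrev CostFamily := (m : ℕ) → Set ((Fin m → ℕ) → Fin m → ℝ)

/-- `𝒞` is closed under composition. -/
def ClosedUnderComposition (𝒞 : CostFamily) : Prop :=
  ∀ m m' : ℕ, ∀ c ∈ 𝒞 m, ∀ c' ∈ 𝒞 m', oplus c c' ∈ 𝒞 (m + m')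

/-- `𝒞` is consistent for unweighted resource graph games: every unweighted
resource graph game whose cost function belongs to `𝒞` has a pure Nash equilibrium. -/
def Consistent (𝒞 : CostFamily) : Prop :=
  ∀ m : ℕ, ∀ c ∈ 𝒞 m, ∀ n : ℕ, ∀ X : Fin n → Finset (Fin m → ℕ),
    IsStrategySets X → ∃ x, IsPNE c X x

/-- The cost of the resource vector `u` when the load vector is `l`. -/
def vecCost {m : ℕ} (c : (Fin m → ℕ) → Fin m → ℝ) (u l : Fin m → ℕ) : ℝ :=
  ∑ r, (u r : ℝ) * c l r

lemma vecCost_zero {m : ℕ} (c : (Fin m → ℕ) → Fin m → ℝ) (l : Fin m → ℕ) :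
    vecCost c 0 l = 0 := by
  simp [vecCost]

lemma vecCost_add {m : ℕ} (c : (Fin m → ℕ) → Fin m → ℝ) (u v l : Fin m → ℕ) :
    vecCost c (u + v) l = vecCost c u l + vecCost c v l := by
  simp [vecCost, add_mul, Finset.sum_add_distrib]

lemma vecCost_indicVec_singleton {m : ℕ} (c : (Fin m → ℕ) → Fin m → ℝ) (r : Fin m)
    (l : Fin m → ℕ) : vecCost c (indicVec {r}) l = c l r := by
  simp [vecCost, indicVec]

lemma vecCost_oplus {m m' : ℕ} (c : (Fin m → ℕ) → Fin m → ℝ)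
    (c' : (Fin m' → ℕ) → Fin m' → ℝ) (u p : Fin m → ℕ) (v q : Fin m' → ℕ) :
    vecCost (oplus c c') (Fin.append u v) (Fin.append p q) =
      vecCost c u p + vecCost c' v q := by
  simp [vecCost, oplus, Fin.sum_univ_add]

lemma Fin.append_add_append {m m' : ℕ} (u p : Fin m → ℕ) (v q : Fin m' → ℕ) :
    Fin.append u v + Fin.append p q = Fin.append (u + p) (v + q) := by
  funext i
  refine Fin.addCases (fun i => ?_) (fun i => ?_) i <;> simp

lemma Fin.append_le_one {m m' : ℕ} {u : Fin m → ℕ} {v : Fin m' → ℕ}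
    (hu : ∀ r, u r ≤ 1) (hv : ∀ r, v r ≤ 1) (r : Fin (m + m')) :
    Fin.append u v r ≤ 1 := by
  refine Fin.addCases (fun i => ?_) (fun i => ?_) r <;> simp [hu, hv]

lemma loadVec_append {n m m' : ℕ} (x : Fin n → Fin m → ℕ) (y : Fin n → Fin m' → ℕ) :
    loadVec (fun i => Fin.append (x i) (y i)) = Fin.append (loadVec x) (loadVec y) := by
  funext r
  refine Fin.addCases (fun i => ?_) (fun i => ?_) r <;> simp [loadVec]

lemma loadVec_cons_cons {n m : ℕ} (u v : Fin m → ℕ) (D : Fin n → Fin m → ℕ) :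
    loadVec (Fin.cons u (Fin.cons v D) : Fin (n + 2) → Fin m → ℕ) = loadVec D + u + v := by
  funext r
  simp [loadVec, Fin.sum_univ_succ]
  ring

/-- Every load vector is induced by some number of `0/1`-vectors. -/
lemma exists_loadVec_eq {m : ℕ} (a : Fin m → ℕ) :
    ∃ (n : ℕ) (D : Fin n → Fin m → ℕ), (∀ j r, D j r ≤ 1) ∧ loadVec D = a := by
  refine ⟨∑ r, a r, fun j r => if (j : ℕ) < a r then 1 else 0,
    fun j r => by dsimp only; split_ifs <;> simp, ?_⟩
  funext r
  have h : a r ≤ ∑ r, a r := Finset.single_le_sum (fun _ _ => Nat.zero_le _) (mem_univ r)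
  simp only [loadVec]
  rw [Fin.sum_univ_eq_sum_range (fun j => if j < a r then 1 else 0), Finset.sum_boole]
  have : (range (∑ r, a r)).filter (fun j => j < a r) = range (a r) := by
    ext j
    simp only [mem_filter, mem_range]
    omega
  simp [this]

/-- In a game with two flexible players, having strategy sets `A` and `B`, and further players
with a single strategy each, some profile of the flexible players is an equilibrium. -/
lemma Consistent.exists_two_player_equilibrium {𝒞 : CostFamily} (hcons : Consistent 𝒞)
    {n m : ℕ} {c : (Fin m → ℕ) → Fin m → ℝ} (hc : c ∈ 𝒞 m) (D : Fin n → Fin m → ℕ)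
    (hD : ∀ j r, D j r ≤ 1) (A B : Finset (Fin m → ℕ)) (hA : A.Nonempty) (hB : B.Nonempty)
    (hA1 : ∀ u ∈ A, ∀ r, u r ≤ 1) (hB1 : ∀ v ∈ B, ∀ r, v r ≤ 1) :
    ∃ u ∈ A, ∃ v ∈ B,
      (∀ u' ∈ A, vecCost c u (loadVec D + u + v) ≤ vecCost c u' (loadVec D + u' + v)) ∧
      ∀ v' ∈ B, vecCost c v (loadVec D + u + v) ≤ vecCost c v' (loadVec D + u + v') := by
  obtain ⟨x, hxX, hx⟩ := hcons m c hc (n + 2)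
    (Fin.cons A (Fin.cons B fun j => {D j})) (by
      constructor
      · intro i
        refine Fin.cases hA (fun i => ?_) i
        exact Fin.cases hB (fun i => by simp) i
      · intro i
        refine Fin.cases hA1 (fun i => ?_) i
        exact Fin.cases hB1 (fun i => by simpa using hD i) i)
  have hx_eq : x = Fin.cons (x 0) (Fin.cons (x 1) D) := by
    funext i
    refine Fin.cases rfl (fun i => ?_) i
    refine Fin.cases rfl (fun i => ?_) i
    simpa using hxX i.succ.succ
  have hx0 := hxX 0
  have hx1 := hxX 1
  have h0 := hx 0
  have h1 := hx 1
  generalize x 0 = u at *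
  generalize x 1 = v at *
  subst hx_eq
  have e1 (w : Fin m → ℕ) :
      Function.update (Fin.cons u (Fin.cons v D) : Fin (n + 2) → Fin m → ℕ) 1 w =
        Fin.cons u (Fin.cons w D) := by
    rw [← Fin.succ_zero_eq_one, ← Fin.cons_update, Fin.update_cons_zero]
  refine ⟨u, hx0, v, hx1, fun u' hu' => ?_, fun v' hv' => ?_⟩
  · have h := h0 u' hu'
    rw [Fin.update_cons_zero] at h
    simp only [playerCost, loadVec_cons_cons] at h
    exact h
  · have h := h1 v' hv'
    rw [e1] at h
    simp only [playerCost, loadVec_cons_cons] at h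
    exact h

/-- Improvement steps around a square of two players, each choosing between no resources
and a fixed set of resources, sum up to zero. -/
lemma vecCost_four_cycle {𝒞 : CostFamily} (hcomp : ClosedUnderComposition 𝒞)
    (hcons : Consistent 𝒞) {m : ℕ} {c : (Fin m → ℕ) → Fin m → ℝ} (hc : c ∈ 𝒞 m)
    (a T V : Fin m → ℕ) (hT : ∀ r, T r ≤ 1) (hV : ∀ r, V r ≤ 1) :
    vecCost c T (a + T) + vecCost c V (a + T + V) =
      vecCost c T (a + T + V) + vecCost c V (a + V) := by
  obtain ⟨n, D, hD, rfl⟩ := exists_loadVec_eq a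
  have hz : ∀ r, (0 : Fin m → ℕ) r ≤ 1 := by simp
  have h2 := hcomp _ _ _ hc _ hc
  obtain ⟨u, hu, v, hv, h0, h1⟩ := hcons.exists_two_player_equilibrium
    (hcomp _ _ _ h2 _ h2)
    (fun j => Fin.append (Fin.append (D j) (D j)) (Fin.append (D j) (D j)))
    (fun j => Fin.append_le_one (Fin.append_le_one (hD j) (hD j))
      (Fin.append_le_one (hD j) (hD j)))
    {Fin.append (Fin.append T V) (Fin.append 0 0),
      Fin.append (Fin.append 0 0) (Fin.append T V)}
    {Fin.append (Fin.append V 0) (Fin.append 0 T),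
      Fin.append (Fin.append 0 T) (Fin.append V 0)}
    (by simp) (by simp)
    (by
      simp only [mem_insert, mem_singleton, forall_eq_or_imp, forall_eq]
      exact ⟨Fin.append_le_one (Fin.append_le_one hT hV) (Fin.append_le_one hz hz),
        Fin.append_le_one (Fin.append_le_one hz hz) (Fin.append_le_one hT hV)⟩)
    (by
      simp only [mem_insert, mem_singleton, forall_eq_or_imp, forall_eq]
      exact ⟨Fin.append_le_one (Fin.append_le_one hV hz) (Fin.append_le_one hz hT),
        Fin.append_le_one (Fin.append_le_one hz hT) (Fin.append_le_one hV hz)⟩)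
  simp only [mem_insert, mem_singleton, forall_eq_or_imp, forall_eq] at hu hv h0 h1
  rcases hu with rfl | rfl <;> rcases hv with rfl | rfl <;>
  · simp only [loadVec_append, Fin.append_add_append, vecCost_oplus, vecCost_zero, add_zero,
      zero_add, add_right_comm (loadVec D) V T] at h0 h1
    linarith

lemma indicVec_le_one {m : ℕ} (S : Finset (Fin m)) (r : Fin m) : indicVec S r ≤ 1 := by
  unfold indicVec
  split_ifs <;> simp

lemma indicVec_add_indicVec_le_one {m : ℕ} {r s : Fin m} (h : r ≠ s) (t : Fin m) :
    (indicVec {r} + indicVec {s}) t ≤ 1 := by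
  simp only [indicVec, Pi.add_apply, mem_singleton]
  split_ifs with h1 h2 <;> simp
  exact h (h1.symm.trans h2)

lemma sub_indicVec_add_indicVec {m : ℕ} {a : Fin m → ℕ} {t : Fin m} (h : 0 < a t) :
    a - indicVec {t} + indicVec {t} = a := by
  funext i
  simp only [indicVec, Pi.add_apply, Pi.sub_apply, mem_singleton]
  split_ifs with hi
  · subst hi
    omega
  · simp

/-- A function on load vectors that is invariant under unit increments is constant. -/
lemma eq_zero_load_of_add_indicVec {m : ℕ} {α : Type*} (h : (Fin m → ℕ) → α)
    (hh : ∀ a t, h (a + indicVec {t}) = h a) (a : Fin m → ℕ) : h a = h 0 := by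
  induction hn : ∑ r, a r generalizing a with
  | zero =>
    congr 1
    funext r
    simpa using (Finset.sum_eq_zero_iff.mp hn) r (mem_univ r)
  | succ k ih =>
    obtain ⟨t, -, ht⟩ : ∃ t ∈ univ, a t ≠ 0 :=
      Finset.exists_ne_zero_of_sum_ne_zero (by omega)
    have e := sub_indicVec_add_indicVec (Nat.pos_of_ne_zero ht)
    rw [← e, hh]
    refine ih _ ?_
    rw [← e] at hn
    simp only [Pi.add_apply, Finset.sum_add_distrib] at hn
    have : ∑ r, indicVec {t} r = 1 := by simp [indicVec]
    omega

/-- Mixed unit differences of the cost function are symmetric. -/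
lemma unit_difference_symm {𝒞 : CostFamily} (hcomp : ClosedUnderComposition 𝒞)
    (hcons : Consistent 𝒞) {m : ℕ} {c : (Fin m → ℕ) → Fin m → ℝ} (hc : c ∈ 𝒞 m)
    (r s : Fin m) (a : Fin m → ℕ) :
    c (a + indicVec {r}) r + c (a + indicVec {r} + indicVec {s}) s =
      c (a + indicVec {r} + indicVec {s}) r + c (a + indicVec {s}) s := by
  simpa only [vecCost_indicVec_singleton] using
    vecCost_four_cycle hcomp hcons hc a _ _ (indicVec_le_one {r}) (indicVec_le_one {s})

/-- Unit differences of the cost function are invariant under unit increments. -/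
lemma unit_difference_add_indicVec {𝒞 : CostFamily} (hcomp : ClosedUnderComposition 𝒞)
    (hcons : Consistent 𝒞) {m : ℕ} {c : (Fin m → ℕ) → Fin m → ℝ} (hc : c ∈ 𝒞 m)
    {r s : Fin m} (hrs : r ≠ s) (a : Fin m → ℕ) (t : Fin m) :
    c (a + indicVec {t} + indicVec {r} + indicVec {s}) r -
        c (a + indicVec {t} + indicVec {r}) r =
      c (a + indicVec {r} + indicVec {s}) r - c (a + indicVec {r}) r := by
  have pair (p q w : Fin m) (hpq : p ≠ q) :
      c (a + indicVec {p} + indicVec {q}) p + c (a + indicVec {p} + indicVec {q}) q +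
          c (a + indicVec {p} + indicVec {q} + indicVec {w}) w =
        c (a + indicVec {p} + indicVec {q} + indicVec {w}) p +
          c (a + indicVec {p} + indicVec {q} + indicVec {w}) q + c (a + indicVec {w}) w := by
    simpa only [vecCost_add, vecCost_indicVec_singleton, ← add_assoc] using
      vecCost_four_cycle hcomp hcons hc a _ _ (indicVec_add_indicVec_le_one hpq)
        (indicVec_le_one {w})
  have symm (p q : Fin m) := unit_difference_symm hcomp hcons hc p q
  by_cases htr : t = r
  · subst htr
    have h1 := pair t s t hrs
    have h2 := symm t s (a + indicVec {t})
    have h3 := symm t s a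
    simp only [add_right_comm _ (indicVec {s}) (indicVec {t})] at h1 h2 h3
    linarith
  by_cases hts : t = s
  · subst hts
    have h1 := pair r t t hrs
    have h3 := symm r t a
    simp only [add_right_comm _ (indicVec {t}) (indicVec {r})] at h1 h3 ⊢
    linarith
  have h1 := pair r t s (Ne.symm htr)
  have h2 := symm r s a
  have h3 := symm t s (a + indicVec {r})
  simp only [add_right_comm _ (indicVec {t}) (indicVec {r})] at h1 h2 h3 ⊢
  linarith

/-- Lemma: for consistent, composition-closed sets of cost functions, the effect of
an additional unit of load on resource `s` on the cost of resource `r` is the same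
for all load vectors with positive load on `r`. -/
theorem diagonal_hesse_unweighted (𝒞 : CostFamily)
    (hcomp : ClosedUnderComposition 𝒞) (hcons : Consistent 𝒞)
    (m : ℕ) (c : (Fin m → ℕ) → Fin m → ℝ) (hc : c ∈ 𝒞 m)
    (r s : Fin m) (hrs : r ≠ s) (x y : Fin m → ℕ)
    (hx : 0 < x r) (hy : 0 < y r) :
    c (x + indicVec {s}) r - c x r = c (y + indicVec {s}) r - c y r := by
  have key (a : Fin m → ℕ) := eq_zero_load_of_add_indicVec
    (fun a => c (a + indicVec {r} + indicVec {s}) r - c (a + indicVec {r}) r)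
    (unit_difference_add_indicVec hcomp hcons hc hrs) a
  have hxy := (key (x - indicVec {r})).trans (key (y - indicVec {r})).symm
  simpa only [sub_indicVec_add_indicVec hx, sub_indicVec_add_indicVec hy] using hxy
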